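/- Let k ≥ 0 and let y satisfy 2^k ≤ y < 2^{k+1}. Let m = 2·⌊(2^{k+2}−y−3)/2⌋ + 1 (the odd element of {2^{k+2}−y−2, 2^{k+2}−y−3}). If y ∉ {2^{k+1}−1, 2^{k+1}−2}, then every (x,z) ∈ ℕ×ℕ with (x mod 2^{k+1}) + (z mod 2^{k+1}) = m belongs to Ulam[y]. If y ∈ {2^{k+1}−1, 2^{k+1}−2}, then every (x,z) with (x mod 2^{k+1}) + (z mod 2^{k+1}) = m and x+z ≠ 2^{k+1}−1 belongs to Ulam[y]. -/

import Mathlib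

/-- Fuel-indexed Ulam predicate: a binary word (as a `List Bool`) of length 1 is Ulam,
and a longer word is Ulam iff it is expressible *uniquely* as a concatenation of two
distinct (nonempty) Ulam words. The fuel strictly exceeds the lengths needed. -/
def ulamAux : ℕ → List Bool → Prop
  | 0, _ => False
  | n + 1, w =>
    if w.length = 1 then True
    else ∃! p : List Bool × List Bool,
      p.1 ≠ [] ∧ p.2 ≠ [] ∧ p.1 ≠ p.2 ∧ w = p.1 ++ p.2 ∧
        ulamAux n p.1 ∧ ulamAux n p.2

/-- A binary word is an Ulam word. -/
def IsUlam (w : List Bool) : Prop := ulamAux w.length w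

/-- The word `0^x 1 0^y`. -/
def wordTwo (x y : ℕ) : List Bool :=
  List.replicate x false ++ [true] ++ List.replicate y false

/-- The word `0^x 1 0^y 1 0^z`. -/
def wordThree (x y z : ℕ) : List Bool :=
  List.replicate x false ++ [true] ++ List.replicate y false ++ [true] ++
    List.replicate z false

/-- `UlamSet y` is the set of pairs `(x,z)` such that `0^x 1 0^y 1 0^z` is Ulam. -/
def UlamSet (y : ℕ) : Set (ℕ × ℕ) := {p | IsUlam (wordThree p.1 y p.2)}

/-- `culam y x z = min(2, N)` where `N` counts `0 ≤ a ≤ y` with both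
`w(x,a)` and `w(y-a,z)` Ulam. -/
noncomputable def culam (y x z : ℕ) : ℕ :=
  min 2 {a : ℕ | a ≤ y ∧ IsUlam (wordTwo x a) ∧ IsUlam (wordTwo (y - a) z)}.ncard

/-- A positive integer is Zumkeller if its binary representation has at most one `0`. -/
def IsZumkeller (y : ℕ) : Prop := 0 < y ∧ (Nat.bits y).count false ≤ 1

/-- The largest `e ≤ d - 1` with `x mod 2^(e+1) < 2^e` and `z mod 2^(e+1) < 2^e`
(and `0` if none exists). -/
def eIdx (d x z : ℕ) : ℕ :=
  Nat.findGreatest (fun e => x % 2 ^ (e + 1) < 2 ^ e ∧ z % 2 ^ (e + 1) < 2 ^ e) (d - 1)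

/-- The universal pattern `E1[d]` on `B_d`. -/
def E1 (d x z : ℕ) : ℕ :=
  if 2 ^ d - 1 ≤ x + z then 0
  else if x % 2 ^ eIdx d x z + z % 2 ^ eIdx d x z < 2 ^ eIdx d x z - 1 then 2 else 1

/-- The universal pattern `E2[d]` on `B_d` (constant `1`). -/
def E2 (_d _x _z : ℕ) : ℕ := 1

/-- The universal pattern `O1[d]` on `B_d`. -/
def O1 (d x z : ℕ) : ℕ :=
  if 2 ^ d - 2 ≤ x + z then 0
  else if (x + z) % 2 = 0 then (if x % 2 = 1 then 0 else 2)
  else if x % 2 ^ eIdx d x z + z % 2 ^ eIdx d x z < 2 ^ eIdx d x z - 1 then 2 else 1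

/-- The universal pattern `O2[d]` on `B_d` (independent of `d`). -/
def O2 (_d x z : ℕ) : ℕ :=
  if (x + z) % 2 = 0 then (if x % 2 = 1 then 0 else 2) else 1

/-- The indicator of `a` and `x` having disjoint binary expansions. -/
def disjBits (a x : ℕ) : ℕ := if a &&& x = 0 then 1 else 0

theorem land_eq_zero_iff_half (a x : ℕ) :
    a &&& x = 0 ↔ (a / 2) &&& (x / 2) = 0 ∧ ¬(a % 2 = 1 ∧ x % 2 = 1) := by
  rw [← Nat.and_mod_two_eq_one, ← Nat.and_div_two]
  omega

@[simp]
theorem disjBits_zero_left (x : ℕ) : disjBits 0 x = 1 := by simp [disjBits]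

@[simp]
theorem disjBits_zero_right (a : ℕ) : disjBits a 0 = 1 := by simp [disjBits]

@[simp]
theorem disjBits_even_even (a x : ℕ) : disjBits (2 * a) (2 * x) = disjBits a x := by
  simp [disjBits, land_eq_zero_iff_half (2 * a)]

@[simp]
theorem disjBits_even_odd (a x : ℕ) : disjBits (2 * a) (2 * x + 1) = disjBits a x := by
  have : (2 * x + 1) / 2 = x := by omega
  simp [disjBits, land_eq_zero_iff_half (2 * a), this]

@[simp]
theorem disjBits_odd_even (a x : ℕ) : disjBits (2 * a + 1) (2 * x) = disjBits a x := by
  have : (2 * a + 1) / 2 = a := by omega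
  simp [disjBits, land_eq_zero_iff_half (2 * a + 1), this]

@[simp]
theorem disjBits_odd_odd (a x : ℕ) : disjBits (2 * a + 1) (2 * x + 1) = 0 := by
  simp [disjBits, land_eq_zero_iff_half (2 * a + 1)]

/-- The parity recursion of Pascal's triangle modulo `2`, for disjointness of bits. -/
theorem disjBits_succ_succ (x y : ℕ) :
    disjBits (x + 1) (y + 1) = if disjBits x (y + 1) + disjBits (x + 1) y = 1 then 1 else 0 := by
  have hle (a b : ℕ) : disjBits a b ≤ 1 := by unfold disjBits; split_ifs <;> simp
  induction x using Nat.strong_induction_on generalizing y with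
  | _ x ih =>
    obtain ⟨i, rfl | rfl⟩ := Nat.even_or_odd' x <;> obtain ⟨j, rfl | rfl⟩ := Nat.even_or_odd' y
    · simp only [disjBits_odd_odd, disjBits_even_odd, disjBits_odd_even]
      have := hle i j
      split_ifs <;> omega
    · have e : 2 * j + 1 + 1 = 2 * (j + 1) := by ring
      have := hle i (j + 1)
      simp only [e, disjBits_odd_odd, disjBits_even_even, disjBits_odd_even]
      split_ifs <;> omega
    · have e : 2 * i + 1 + 1 = 2 * (i + 1) := by ring
      have := hle (i + 1) j
      simp only [e, disjBits_odd_odd, disjBits_even_even, disjBits_even_odd]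
      split_ifs <;> omega
    · have e (i : ℕ) : 2 * i + 1 + 1 = 2 * (i + 1) := by ring
      simp only [e, disjBits_even_even, disjBits_odd_even, disjBits_even_odd]
      exact ih i (by omega) j

/-- The number of `a < n` such that `a` is bitwise disjoint from `x` and `n - 1 - a` is bitwise
disjoint from `z`. -/
def splitCount (n x z : ℕ) : ℕ :=
  ∑ a ∈ Finset.range n, disjBits a x * disjBits (n - 1 - a) z

theorem sum_range_two_mul (f : ℕ → ℕ) (n : ℕ) :
    ∑ a ∈ Finset.range (2 * n), f a = ∑ a ∈ Finset.range n, (f (2 * a) + f (2 * a + 1)) := by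
  induction n with
  | zero => simp
  | succ n ih => rw [Finset.sum_range_succ, ← ih, show 2 * (n + 1) = 2 * n + 1 + 1 by ring,
      Finset.sum_range_succ, Finset.sum_range_succ]; ring

theorem splitCount_two_mul (n x z : ℕ) :
    splitCount (2 * n) x z = ∑ a ∈ Finset.range n,
      (disjBits (2 * a) x * disjBits (2 * (n - 1 - a) + 1) z +
        disjBits (2 * a + 1) x * disjBits (2 * (n - 1 - a)) z) := by
  rw [splitCount, sum_range_two_mul]
  refine Finset.sum_congr rfl fun a ha => ?_
  have := Finset.mem_range.1 ha
  rw [show 2 * n - 1 - 2 * a = 2 * (n - 1 - a) + 1 by omega,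
    show 2 * n - 1 - (2 * a + 1) = 2 * (n - 1 - a) by omega]

theorem splitCount_two_mul_add_one (n x z : ℕ) :
    splitCount (2 * n + 1) x z =
      ∑ a ∈ Finset.range (n + 1), disjBits (2 * a) x * disjBits (2 * (n + 1 - 1 - a)) z +
      ∑ a ∈ Finset.range n, disjBits (2 * a + 1) x * disjBits (2 * (n - 1 - a) + 1) z := by
  rw [splitCount, Finset.sum_range_succ, sum_range_two_mul, Finset.sum_add_distrib,
    Finset.sum_range_succ _ n]
  have h1 : ∑ a ∈ Finset.range n, disjBits (2 * a) x * disjBits (2 * n + 1 - 1 - 2 * a) z =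
      ∑ a ∈ Finset.range n, disjBits (2 * a) x * disjBits (2 * (n + 1 - 1 - a)) z :=
    Finset.sum_congr rfl fun a _ => by
      rw [show 2 * n + 1 - 1 - 2 * a = 2 * (n + 1 - 1 - a) by omega]
  have h2 : ∑ a ∈ Finset.range n, disjBits (2 * a + 1) x *
        disjBits (2 * n + 1 - 1 - (2 * a + 1)) z =
      ∑ a ∈ Finset.range n, disjBits (2 * a + 1) x * disjBits (2 * (n - 1 - a) + 1) z :=
    Finset.sum_congr rfl fun a ha => by
      have := Finset.mem_range.1 ha
      rw [show 2 * n + 1 - 1 - (2 * a + 1) = 2 * (n - 1 - a) + 1 by omega]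
  rw [h1, h2]
  simp
  ring

theorem splitCount_zero (x z : ℕ) : splitCount 0 x z = 0 := rfl

theorem splitCount_one (x z : ℕ) : splitCount 1 x z = 1 := by simp [splitCount]

theorem splitCount_even_ee (n i j : ℕ) :
    splitCount (2 * n) (2 * i) (2 * j) = 2 * splitCount n i j := by
  rw [splitCount_two_mul, splitCount, Finset.mul_sum]
  exact Finset.sum_congr rfl fun a _ => by simp; ring

theorem splitCount_even_eo (n i j : ℕ) :
    splitCount (2 * n) (2 * i) (2 * j + 1) = splitCount n i j := by
  rw [splitCount_two_mul]
  simp [splitCount]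

theorem splitCount_even_oe (n i j : ℕ) :
    splitCount (2 * n) (2 * i + 1) (2 * j) = splitCount n i j := by
  rw [splitCount_two_mul]
  simp [splitCount]

theorem splitCount_even_oo (n i j : ℕ) :
    splitCount (2 * n) (2 * i + 1) (2 * j + 1) = 0 := by
  rw [splitCount_two_mul]
  simp

theorem splitCount_odd_ee (n i j : ℕ) :
    splitCount (2 * n + 1) (2 * i) (2 * j) = splitCount (n + 1) i j + splitCount n i j := by
  rw [splitCount_two_mul_add_one]
  simp [splitCount]

theorem splitCount_odd_eo (n i j : ℕ) :
    splitCount (2 * n + 1) (2 * i) (2 * j + 1) = splitCount (n + 1) i j := by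
  rw [splitCount_two_mul_add_one]
  simp [splitCount]

theorem splitCount_odd_oe (n i j : ℕ) :
    splitCount (2 * n + 1) (2 * i + 1) (2 * j) = splitCount (n + 1) i j := by
  rw [splitCount_two_mul_add_one]
  simp [splitCount]

theorem splitCount_odd_oo (n i j : ℕ) :
    splitCount (2 * n + 1) (2 * i + 1) (2 * j + 1) = splitCount (n + 1) i j := by
  rw [splitCount_two_mul_add_one]
  simp [splitCount]

theorem splitCount_comm (n x z : ℕ) : splitCount n x z = splitCount n z x := by
  rw [splitCount, splitCount, ← Finset.sum_range_reflect]
  refine Finset.sum_congr rfl fun a ha => ?_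
  have := Finset.mem_range.1 ha
  rw [show n - 1 - (n - 1 - a) = a by omega, mul_comm]

theorem two_mul_mod_two_pow_succ (i k : ℕ) : 2 * i % 2 ^ (k + 1) = 2 * (i % 2 ^ k) := by
  rw [pow_succ', Nat.mul_mod_mul_left]

theorem two_mul_add_one_mod_two_pow_succ (i k : ℕ) :
    (2 * i + 1) % 2 ^ (k + 1) = 2 * (i % 2 ^ k) + 1 := by
  rw [pow_succ', Nat.mod_mul, show (2 * i + 1) / 2 = i by omega]
  omega

theorem splitCount_eq_zero {k n x z : ℕ} (hn : n ≤ 2 ^ k)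
    (h : 2 * 2 ^ k < x % 2 ^ k + z % 2 ^ k + n + 1) : splitCount n x z = 0 := by
  induction k generalizing n x z with
  | zero => simp [Nat.mod_one] at *; omega
  | succ k ih =>
    have hp := pow_succ 2 k
    obtain ⟨w, rfl | rfl⟩ := Nat.even_or_odd' n <;>
    obtain ⟨i, rfl | rfl⟩ := Nat.even_or_odd' x <;>
    obtain ⟨j, rfl | rfl⟩ := Nat.even_or_odd' z <;>
    simp only [two_mul_mod_two_pow_succ, two_mul_add_one_mod_two_pow_succ] at h
    · rw [splitCount_even_ee, ih (by omega) (by omega)]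
    · rw [splitCount_even_eo, ih (by omega) (by omega)]
    · rw [splitCount_even_oe, ih (by omega) (by omega)]
    · exact splitCount_even_oo ..
    · rw [splitCount_odd_ee, ih (by omega) (by omega), ih (by omega) (by omega)]
    · rw [splitCount_odd_eo, ih (by omega) (by omega)]
    · rw [splitCount_odd_oe, ih (by omega) (by omega)]
    · rw [splitCount_odd_oo, ih (by omega) (by omega)]

theorem splitCount_eq_one {k n x z : ℕ} (hn : n ≤ 2 ^ k)
    (h : 2 * 2 ^ k = x % 2 ^ k + z % 2 ^ k + n + 1) : splitCount n x z = 1 := by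
  induction k generalizing n x z with
  | zero =>
    obtain rfl : n = 1 := by simp [Nat.mod_one] at *; omega
    exact splitCount_one x z
  | succ k ih =>
    have hp := pow_succ 2 k
    obtain ⟨w, rfl | rfl⟩ := Nat.even_or_odd' n <;>
    obtain ⟨i, rfl | rfl⟩ := Nat.even_or_odd' x <;>
    obtain ⟨j, rfl | rfl⟩ := Nat.even_or_odd' z <;>
    simp only [two_mul_mod_two_pow_succ, two_mul_add_one_mod_two_pow_succ] at h
    · omega
    · rw [splitCount_even_eo, ih (by omega) (by omega)]
    · rw [splitCount_even_oe, ih (by omega) (by omega)]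
    · omega
    · rw [splitCount_odd_ee, splitCount_eq_zero (k := k) (by omega) (by omega), ih (by omega) (by omega)]
    · omega
    · omega
    · rw [splitCount_odd_oo, ih (by omega) (by omega)]

theorem splitCount_odd_eq_one {k w x z : ℕ} (hn : 2 * w + 1 ≤ 2 ^ k)
    (h : 2 * 2 ^ k = x % 2 ^ k + z % 2 ^ k + (2 * w + 1) + 2) :
    splitCount (2 * w + 1) x z = 1 := by
  obtain _ | k := k
  · simp [Nat.mod_one] at h
  have hp := pow_succ 2 k
  obtain ⟨i, rfl | rfl⟩ := Nat.even_or_odd' x <;>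
  obtain ⟨j, rfl | rfl⟩ := Nat.even_or_odd' z <;>
  simp only [two_mul_mod_two_pow_succ, two_mul_add_one_mod_two_pow_succ] at h
  · omega
  · rw [splitCount_odd_eo, splitCount_eq_one (k := k) (by omega) (by omega)]
  · rw [splitCount_odd_oe, splitCount_eq_one (k := k) (by omega) (by omega)]
  · omega

theorem splitCount_even_eq_two {k w i j : ℕ} (hn : w ≤ 2 ^ k)
    (h : 2 * 2 ^ k = i % 2 ^ k + j % 2 ^ k + w + 1) :
    splitCount (2 * w) (2 * i) (2 * j) = 2 := by
  rw [splitCount_even_ee, splitCount_eq_one hn h]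

theorem splitCount_add_succ_parity (m i j : ℕ) :
    (splitCount (m + 1) (i + 1) j + splitCount m (i + 1) j) % 2 =
      splitCount (m + 1) i j % 2 := by
  induction m using Nat.strong_induction_on generalizing i j with
  | _ m ih =>
  obtain rfl | hm := Nat.eq_zero_or_pos m
  · simp [splitCount_one, splitCount_zero]
  have e (i : ℕ) : 2 * i + 1 + 1 = 2 * (i + 1) := by ring
  obtain ⟨w, rfl | rfl⟩ := Nat.even_or_odd' m <;>
  obtain ⟨i, rfl | rfl⟩ := Nat.even_or_odd' i <;>
  obtain ⟨j, rfl | rfl⟩ := Nat.even_or_odd' j <;>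
  simp only [e, splitCount_even_ee, splitCount_even_eo, splitCount_even_oe, splitCount_even_oo,
    splitCount_odd_ee, splitCount_odd_eo, splitCount_odd_oe, splitCount_odd_oo] <;>
  first
  | omega
  | have := ih w (by omega) i j
    omega

theorem splitCount_add_succ_parity' (m i j : ℕ) :
    (splitCount (m + 1) i (j + 1) + splitCount m i (j + 1)) % 2 =
      splitCount (m + 1) i j % 2 := by
  simpa only [splitCount_comm _ _ i] using splitCount_add_succ_parity m j i

theorem exists_splitCount_pred_eq_one {m i j : ℕ} (hm : 0 < m)
    (h : splitCount (m + 1) i j + splitCount m i j = 1) :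
    (i ≠ 0 ∧ splitCount (m + 1) (i - 1) j = 1) ∨
      (j ≠ 0 ∧ splitCount (m + 1) i (j - 1) = 1) := by
  induction m using Nat.strong_induction_on generalizing i j with
  | _ m ih =>
  have e (i : ℕ) : 2 * i + 1 + 1 = 2 * (i + 1) := by ring
  have e' (i : ℕ) (hi : i ≠ 0) : 2 * i - 1 = 2 * (i - 1) + 1 := by omega
  have key {w i j : ℕ} (hw : w < m) (h : splitCount (w + 1) i j + splitCount w i j = 1)
      (h0 : w ≠ 0) := ih w hw (Nat.pos_of_ne_zero h0) h
  have n0 {w i j : ℕ} (h : splitCount (w + 1) i j = 0) : w ≠ 0 := by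
    rintro rfl
    simp [splitCount_one] at h
  obtain ⟨w, rfl | rfl⟩ := Nat.even_or_odd' m <;>
  obtain ⟨i, rfl | rfl⟩ := Nat.even_or_odd' i <;>
  obtain ⟨j, rfl | rfl⟩ := Nat.even_or_odd' j <;>
  simp only [e, splitCount_even_ee, splitCount_even_eo, splitCount_even_oe, splitCount_even_oo,
    splitCount_odd_ee, splitCount_odd_eo, splitCount_odd_oe, splitCount_odd_oo] at h
  · obtain ⟨hi, h⟩ | ⟨hj, h⟩ := key (w := w) (i := i) (j := j) (by omega) (by omega) (by omega)
    · exact .inl ⟨by omega, by rw [e' i hi, splitCount_odd_oe, h]⟩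
    · exact .inr ⟨by omega, by rw [e' j hj, splitCount_odd_eo, h]⟩
  · exact .inr ⟨by omega, by rw [Nat.add_sub_cancel, splitCount_odd_ee, h]⟩
  · exact .inl ⟨by omega, by rw [Nat.add_sub_cancel, splitCount_odd_ee, h]⟩
  · exact .inl ⟨by omega, by rw [Nat.add_sub_cancel, splitCount_odd_eo]; omega⟩
  · have := n0 (w := w) (i := i) (j := j) (by omega)
    obtain ⟨hi, h⟩ | ⟨hj, h⟩ := key (w := w) (i := i) (j := j) (by omega) (by omega) this
    · exact .inl ⟨by omega, by rw [e' i hi, e, splitCount_even_oe, h]⟩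
    · exact .inr ⟨by omega, by rw [e' j hj, e, splitCount_even_eo, h]⟩
  · omega
  · omega
  · exact .inl ⟨by omega, by rw [Nat.add_sub_cancel, e, splitCount_even_eo]; omega⟩

theorem splitCount_pos_of_disjBits {i j : ℕ} (h : disjBits i j = 1) :
    0 < splitCount (i + j + 1) i j := by
  rw [splitCount]
  refine lt_of_lt_of_le ?_ (Finset.single_le_sum (fun _ _ => Nat.zero_le _)
    (Finset.mem_range.2 (by omega : j < i + j + 1)))
  rw [show i + j + 1 - 1 - j = i by omega, h, mul_one]
  unfold disjBits at *
  rw [Nat.and_comm]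
  split_ifs at *
  exact Nat.one_pos

theorem splitCount_add_pos_of_disjBits {i j : ℕ} (h : disjBits i j = 1) (h0 : i + j ≠ 0) :
    0 < splitCount (i + j) i j := by
  induction hs : i + j using Nat.strong_induction_on generalizing i j with
  | _ n ih =>
  subst hs
  have e (i j : ℕ) : 2 * i + 1 + 2 * j = 2 * (i + j) + 1 := by ring
  obtain ⟨i, rfl | rfl⟩ := Nat.even_or_odd' i <;>
  obtain ⟨j, rfl | rfl⟩ := Nat.even_or_odd' j <;>
  simp only [disjBits_even_even, disjBits_even_odd, disjBits_odd_even, disjBits_odd_odd] at h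
  · rw [← mul_add, splitCount_even_ee]
    have := ih (i + j) (by omega) h (by omega) rfl
    omega
  · rw [← add_assoc, ← mul_add, splitCount_odd_eo]
    exact splitCount_pos_of_disjBits h
  · rw [e, splitCount_odd_oe]
    exact splitCount_pos_of_disjBits h
  · omega

theorem two_le_splitCount_of_disjBits {i j : ℕ} (h : disjBits i j = 1)
    (h0 : ∀ q, i + j + 1 ≠ 2 ^ q) : 2 ≤ splitCount (i + j + 1) i j := by
  induction hs : i + j using Nat.strong_induction_on generalizing i j with
  | _ n ih =>
  subst hs
  have h00 := h0 0
  have e (i j : ℕ) : 2 * i + 1 + 2 * j + 1 = 2 * (i + j + 1) := by ring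
  have e' (i j : ℕ) : 2 * i + (2 * j + 1) + 1 = 2 * (i + j + 1) := by ring
  have h0' {i j : ℕ} (h0 : ∀ q, 2 * (i + j + 1) ≠ 2 ^ q) (q : ℕ) : i + j + 1 ≠ 2 ^ q := by
    have := h0 (q + 1)
    rw [pow_succ'] at this
    omega
  obtain ⟨i, rfl | rfl⟩ := Nat.even_or_odd' i <;>
  obtain ⟨j, rfl | rfl⟩ := Nat.even_or_odd' j <;>
  simp only [disjBits_even_even, disjBits_even_odd, disjBits_odd_even, disjBits_odd_odd] at h
  · rw [← mul_add, splitCount_odd_ee]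
    have := splitCount_pos_of_disjBits h
    have := splitCount_add_pos_of_disjBits h (by omega)
    omega
  · rw [e'] at h0 ⊢
    rw [splitCount_even_eo]
    exact ih (i + j) (by omega) h (h0' h0) rfl
  · rw [e] at h0 ⊢
    rw [splitCount_even_oe]
    exact ih (i + j) (by omega) h (h0' h0) rfl
  · omega

theorem three_le_splitCount_of_disjBits {i j : ℕ} (h : disjBits i j = 1)
    (h0 : ∀ q, i + j + 1 ≠ 2 ^ q) :
    3 ≤ splitCount (i + j + 1) i j + splitCount (i + j) i j := by
  have h2 := two_le_splitCount_of_disjBits h h0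
  have h00 := h0 0
  have e (i j : ℕ) : 2 * i + 1 + 2 * j = 2 * (i + j) + 1 := by ring
  obtain ⟨i, rfl | rfl⟩ := Nat.even_or_odd' i <;>
  obtain ⟨j, rfl | rfl⟩ := Nat.even_or_odd' j <;>
  simp only [disjBits_even_even, disjBits_even_odd, disjBits_odd_even, disjBits_odd_odd] at h
  · have := splitCount_add_pos_of_disjBits h (by omega)
    rw [← mul_add] at h2 ⊢
    rw [splitCount_even_ee]
    omega
  · rw [← add_assoc, ← mul_add, show 2 * (i + j) + 1 + 1 = 2 * (i + j + 1) by ring] at h2 ⊢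
    rw [splitCount_even_eo] at h2 ⊢
    rw [splitCount_odd_eo]
    omega
  · rw [e, show 2 * (i + j) + 1 + 1 = 2 * (i + j + 1) by ring] at h2 ⊢
    rw [splitCount_even_oe] at h2 ⊢
    rw [splitCount_odd_oe]
    omega
  · omega

theorem not_ulamAux_nil (n : ℕ) : ¬ ulamAux n [] := by
  cases n with
  | zero => simp [ulamAux]
  | succ n =>
    simp only [ulamAux, List.nil_eq, List.append_eq_nil_iff]
    rintro ⟨p, ⟨h1, -, -, h2, -⟩, -⟩
    exact h1 h2.1

theorem ulamAux_eq_of_length_le {n m : ℕ} {w : List Bool} (hn : w.length ≤ n)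
    (hm : w.length ≤ m) : ulamAux n w ↔ ulamAux m w := by
  induction n generalizing m w with
  | zero =>
    obtain rfl : w = [] := List.length_eq_zero_iff.1 (by omega)
    simp [not_ulamAux_nil]
  | succ n ih =>
    obtain _ | m := m
    · obtain rfl : w = [] := List.length_eq_zero_iff.1 (by omega)
      simp [not_ulamAux_nil]
    rw [ulamAux, ulamAux]
    split_ifs with h1
    · rfl
    refine existsUnique_congr fun p => ?_
    refine and_congr_right fun hp1 => and_congr_right fun hp2 => and_congr_right fun _ =>
      and_congr_right fun hw => ?_
    have := List.length_pos_of_ne_nil hp1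
    have := List.length_pos_of_ne_nil hp2
    have : w.length = p.1.length + p.2.length := by rw [hw, List.length_append]
    rw [ih (m := m) (by omega) (by omega), ih (m := m) (by omega) (by omega)]

theorem not_isUlam_nil : ¬ IsUlam [] := not_ulamAux_nil 0

theorem isUlam_iff_existsUnique (w : List Bool) :
    IsUlam w ↔ w.length = 1 ∨ ∃! p : List Bool × List Bool,
      p.1 ≠ p.2 ∧ w = p.1 ++ p.2 ∧ IsUlam p.1 ∧ IsUlam p.2 := by
  have h1 : IsUlam w ↔ ulamAux (w.length + 1) w := ulamAux_eq_of_length_le le_rfl (by omega)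
  rw [h1, ulamAux]
  split_ifs with h
  · simp [h]
  simp only [h, false_or]
  refine existsUnique_congr fun p => ⟨?_, ?_⟩
  · rintro ⟨-, -, hne, hw, hp1, hp2⟩
    have : w.length = p.1.length + p.2.length := by rw [hw, List.length_append]
    exact ⟨hne, hw, (ulamAux_eq_of_length_le (by omega) le_rfl).1 hp1,
      (ulamAux_eq_of_length_le (by omega) le_rfl).1 hp2⟩
  · rintro ⟨hne, hw, hp1, hp2⟩
    have : w.length = p.1.length + p.2.length := by rw [hw, List.length_append]
    exact ⟨fun h => not_isUlam_nil (h ▸ hp1), fun h => not_isUlam_nil (h ▸ hp2), hne, hw,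
      (ulamAux_eq_of_length_le le_rfl (by omega)).1 hp1,
      (ulamAux_eq_of_length_le le_rfl (by omega)).1 hp2⟩

theorem isUlam_replicate (n : ℕ) (b : Bool) : IsUlam (List.replicate n b) ↔ n = 1 := by
  rw [isUlam_iff_existsUnique, List.length_replicate, or_iff_left]
  rintro ⟨p, ⟨hne, hw, h1, h2⟩, hu⟩
  obtain ⟨hl, e1, e2⟩ := List.append_eq_replicate_iff.1 hw.symm
  refine hne (congrArg Prod.snd (hu (p.2, p.1) ⟨hne.symm, ?_, h2, h1⟩))
  exact (List.append_eq_replicate_iff.2 ⟨by omega, e2, e1⟩).symm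

open Classical in
/-- The indicator of `(u, v)` being a pair of distinct Ulam words. -/
noncomputable def pairInd (u v : List Bool) : ℕ :=
  if u ≠ v ∧ IsUlam u ∧ IsUlam v then 1 else 0

open Classical in
/-- The indicator of being an Ulam word. -/
noncomputable def ulamInd (w : List Bool) : ℕ := if IsUlam w then 1 else 0

theorem isUlam_iff_sum_pairInd {w : List Bool} (hw : 2 ≤ w.length) :
    IsUlam w ↔
      ∑ t ∈ Finset.range (w.length - 1), pairInd (w.take (t + 1)) (w.drop (t + 1)) = 1 := by
  classical
  rw [isUlam_iff_existsUnique, or_iff_right (by omega)]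
  simp only [pairInd]
  rw [← Finset.card_filter, Finset.card_eq_one_iff_existsUnique]
  simp only [Finset.mem_filter, Finset.mem_range]
  constructor
  · rintro ⟨⟨u, v⟩, ⟨hne, rfl, hu, hv⟩, huniq⟩
    have hu0 : 0 < u.length := List.length_pos_of_ne_nil fun h => not_isUlam_nil (h ▸ hu)
    have hv0 : 0 < v.length := List.length_pos_of_ne_nil fun h => not_isUlam_nil (h ▸ hv)
    have hul : u.length - 1 + 1 = u.length := by omega
    refine ⟨u.length - 1, ⟨by simp; omega, ?_⟩, ?_⟩
    · simpa [hul] using ⟨hne, hu, hv⟩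
    · rintro t ⟨ht, h⟩
      have := congrArg (fun p : List Bool × List Bool => p.1.length)
        (huniq ((u ++ v).take (t + 1), (u ++ v).drop (t + 1)) ⟨h.1, by simp, h.2⟩)
      simp only [List.length_append, List.length_take] at this ht
      omega
  · rintro ⟨t, ⟨ht, h⟩, huniq⟩
    refine ⟨(w.take (t + 1), w.drop (t + 1)), ⟨h.1, by simp, h.2⟩, ?_⟩
    rintro ⟨u, v⟩ ⟨hne, rfl, hu, hv⟩
    have hu0 : 0 < u.length := List.length_pos_of_ne_nil fun h => not_isUlam_nil (h ▸ hu)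
    have hv0 : 0 < v.length := List.length_pos_of_ne_nil fun h => not_isUlam_nil (h ▸ hv)
    have hul : u.length - 1 + 1 = u.length := by omega
    have : u.length - 1 = t :=
      huniq _ ⟨by simp; omega, by simpa [hul] using ⟨hne, hu, hv⟩⟩
    simp [← this, hul]

theorem pairInd_take_drop {w u v : List Bool} {t : ℕ} (h : w = u ++ v) (ht : u.length = t) :
    pairInd (w.take t) (w.drop t) = pairInd u v := by
  subst h ht
  simp

@[simp]
theorem length_wordTwo (x y : ℕ) : (wordTwo x y).length = x + y + 1 := by
  simp [wordTwo]; omega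

@[simp]
theorem length_wordThree (x y z : ℕ) : (wordThree x y z).length = x + y + z + 2 := by
  simp [wordThree]; omega

theorem replicate_ne_of_mem_true {n : ℕ} {w : List Bool} (h : true ∈ w) :
    List.replicate n false ≠ w := by
  rintro rfl
  simp at h

theorem pairInd_replicate_left {n : ℕ} {w : List Bool} (h : true ∈ w) :
    pairInd (List.replicate n false) w = if n = 1 then ulamInd w else 0 := by
  rw [pairInd, ulamInd, isUlam_replicate]
  have := replicate_ne_of_mem_true (n := n) h
  split_ifs <;> simp_all

theorem pairInd_replicate_right {n : ℕ} {w : List Bool} (h : true ∈ w) :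
    pairInd w (List.replicate n false) = if n = 1 then ulamInd w else 0 := by
  rw [pairInd, ulamInd, isUlam_replicate]
  have := (replicate_ne_of_mem_true (n := n) h).symm
  split_ifs <;> simp_all

theorem true_mem_wordTwo (x y : ℕ) : true ∈ wordTwo x y := by simp [wordTwo]

theorem true_mem_wordThree (x y z : ℕ) : true ∈ wordThree x y z := by simp [wordThree]

theorem replicate_append_replicate_of_add_eq {a b n : ℕ} (h : a + b = n) (c : Bool) :
    List.replicate n c = List.replicate a c ++ List.replicate b c := by
  rw [← h, List.replicate_add]

theorem wordTwo_eq_replicate_append {a b x : ℕ} (h : a + b = x) (y : ℕ) :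
    wordTwo x y = List.replicate a false ++ wordTwo b y := by
  rw [wordTwo, wordTwo, replicate_append_replicate_of_add_eq h]
  simp only [List.append_assoc]

theorem wordTwo_eq_append_replicate {a b y : ℕ} (h : a + b = y) (x : ℕ) :
    wordTwo x y = wordTwo x a ++ List.replicate b false := by
  rw [wordTwo, wordTwo, replicate_append_replicate_of_add_eq h]
  simp only [List.append_assoc]

theorem wordThree_eq_replicate_append {a b x : ℕ} (h : a + b = x) (y z : ℕ) :
    wordThree x y z = List.replicate a false ++ wordThree b y z := by
  rw [wordThree, wordThree, replicate_append_replicate_of_add_eq h]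
  simp only [List.append_assoc]

theorem wordThree_eq_append_replicate {a b z : ℕ} (h : a + b = z) (x y : ℕ) :
    wordThree x y z = wordThree x y a ++ List.replicate b false := by
  rw [wordThree, wordThree, replicate_append_replicate_of_add_eq h]
  simp only [List.append_assoc]

theorem wordThree_eq_wordTwo_append {a b y : ℕ} (h : a + b = y) (x z : ℕ) :
    wordThree x y z = wordTwo x a ++ wordTwo b z := by
  rw [wordThree, wordTwo, wordTwo, replicate_append_replicate_of_add_eq h]
  simp only [List.append_assoc]

theorem wordTwo_inj {x y x' y' : ℕ} : wordTwo x y = wordTwo x' y' ↔ x = x' ∧ y = y' := by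
  refine ⟨fun h => ?_, by rintro ⟨rfl, rfl⟩; rfl⟩
  have hx (x y : ℕ) : (wordTwo x y).idxOf true = x := by
    rw [wordTwo, List.append_assoc, List.idxOf_append_of_notMem (by simp)]
    simp
  have h1 := congrArg (List.idxOf true) h
  have h2 := congrArg List.length h
  simp only [hx, length_wordTwo] at h1 h2
  omega

theorem sum_range_ite_eq_zero (c : ℕ → ℕ) (n : ℕ) :
    ∑ t ∈ Finset.range n, (if t + 1 = 1 then c t else 0) = if n = 0 then 0 else c 0 := by
  cases n <;> simp [Finset.sum_ite_eq']

theorem sum_range_ite_sub_eq_one (c : ℕ → ℕ) (n : ℕ) :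
    ∑ t ∈ Finset.range n, (if n - t = 1 then c t else 0) = if n = 0 then 0 else c (n - 1) := by
  obtain _ | n := n
  · simp
  have : ∀ t ∈ Finset.range (n + 1), (if n + 1 - t = 1 then c t else 0) =
      if t = n then c t else 0 := fun t ht => by
    have := Finset.mem_range.1 ht
    exact if_congr (by omega) rfl rfl
  rw [Finset.sum_congr rfl this]
  simp

theorem isUlam_wordTwo_iff_sum {x y : ℕ} (h : x + y ≠ 0) :
    IsUlam (wordTwo x y) ↔
      (if x = 0 then 0 else ulamInd (wordTwo (x - 1) y)) +
        (if y = 0 then 0 else ulamInd (wordTwo x (y - 1))) = 1 := by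
  have hx := sum_range_ite_eq_zero (fun t => ulamInd (wordTwo (x - 1 - t) y)) x
  rw [Nat.sub_zero] at hx
  rw [isUlam_iff_sum_pairInd (by simp; omega), length_wordTwo, Nat.add_sub_cancel,
    Finset.sum_range_add, ← hx, ← sum_range_ite_sub_eq_one (fun t => ulamInd (wordTwo x t))]
  refine iff_of_eq (congrArg₂ _ (congrArg₂ _ (Finset.sum_congr rfl fun t ht => ?_)
    (Finset.sum_congr rfl fun t ht => ?_)) rfl)
  · have := Finset.mem_range.1 ht
    rw [pairInd_take_drop (wordTwo_eq_replicate_append (a := t + 1) (b := x - 1 - t) (by omega) y)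
      (by simp), pairInd_replicate_left (true_mem_wordTwo _ _)]
  · have := Finset.mem_range.1 ht
    rw [pairInd_take_drop (wordTwo_eq_append_replicate (a := t) (b := y - t) (by omega) x)
      (by simp), pairInd_replicate_right (true_mem_wordTwo _ _)]

theorem ulamInd_wordTwo (x y : ℕ) : ulamInd (wordTwo x y) = disjBits x y := by
  induction hn : x + y generalizing x y with
  | zero =>
    obtain ⟨rfl, rfl⟩ : x = 0 ∧ y = 0 := by omega
    simp [ulamInd, wordTwo, IsUlam, ulamAux]
  | succ n ih =>
    rw [ulamInd, isUlam_wordTwo_iff_sum (by omega)]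
    obtain _ | x := x
    · obtain ⟨y, rfl⟩ : ∃ y', y = y' + 1 := ⟨y - 1, by omega⟩
      simp [ih 0 y (by omega)]
    obtain _ | y := y
    · simp [ih x 0 (by omega)]
    simp [ih x (y + 1) (by omega), ih (x + 1) y (by omega), disjBits_succ_succ]

theorem disjBits_comm (x y : ℕ) : disjBits x y = disjBits y x := by
  rw [disjBits, disjBits, Nat.and_comm]

theorem pairInd_wordTwo_add (x a b z : ℕ) :
    pairInd (wordTwo x a) (wordTwo b z) +
      (if a = z then (if x = b then disjBits x z else 0) else 0) =
      disjBits a x * disjBits b z := by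
  classical
  simp only [pairInd, ne_eq, wordTwo_inj]
  rw [disjBits_comm a x, ← ulamInd_wordTwo x a, ← ulamInd_wordTwo b z,
    ← ulamInd_wordTwo x z]
  unfold ulamInd
  by_cases h1 : a = z
  · by_cases h2 : x = b
    · subst h1 h2; simp
    · simp [h1, h2, ite_and]
      split_ifs <;> simp
  · simp [h1, ite_and]
    split_ifs <;> simp

/-- The number of splittings of `0^x 1 0^y 1 0^z` into two distinct Ulam words with one `1` each. -/
def properSplitCount (y x z : ℕ) : ℕ :=
  splitCount (y + 1) x z - if x + z = y then disjBits x z else 0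

theorem sum_pairInd_wordTwo (y x z : ℕ) :
    ∑ a ∈ Finset.range (y + 1), pairInd (wordTwo x a) (wordTwo (y - a) z) =
      properSplitCount y x z := by
  have h := Finset.sum_congr rfl fun a (_ : a ∈ Finset.range (y + 1)) =>
    pairInd_wordTwo_add x a (y - a) z
  rw [Finset.sum_add_distrib, Finset.sum_ite_eq'] at h
  have h' : (if z ∈ Finset.range (y + 1) then if x = y - z then disjBits x z else 0 else 0) =
      if x + z = y then disjBits x z else 0 := by
    simp only [Finset.mem_range]
    split_ifs <;> first | rfl | omega
  rw [h'] at h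
  rw [properSplitCount, splitCount, Nat.add_sub_cancel, ← h, Nat.add_sub_cancel]

theorem isUlam_wordThree_iff (x y z : ℕ) :
    IsUlam (wordThree x y z) ↔
      (if x = 0 then 0 else ulamInd (wordThree (x - 1) y z)) + properSplitCount y x z +
        (if z = 0 then 0 else ulamInd (wordThree x y (z - 1))) = 1 := by
  have hx := sum_range_ite_eq_zero (fun t => ulamInd (wordThree (x - 1 - t) y z)) x
  rw [Nat.sub_zero] at hx
  rw [isUlam_iff_sum_pairInd (by simp), length_wordThree,
    show x + y + z + 2 - 1 = x + (y + 1) + z by omega, Finset.sum_range_add, Finset.sum_range_add,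
    ← sum_pairInd_wordTwo,
    ← hx, ← sum_range_ite_sub_eq_one (fun t => ulamInd (wordThree x y t))]
  refine iff_of_eq (congrArg₂ _ (congrArg₂ _ (congrArg₂ _ (Finset.sum_congr rfl fun t ht => ?_)
    (Finset.sum_congr rfl fun t ht => ?_)) (Finset.sum_congr rfl fun t ht => ?_)) rfl)
  · have := Finset.mem_range.1 ht
    rw [pairInd_take_drop
      (wordThree_eq_replicate_append (a := t + 1) (b := x - 1 - t) (by omega) y z)
      (by simp), pairInd_replicate_left (true_mem_wordThree _ _ _)]
  · have := Finset.mem_range.1 ht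
    rw [pairInd_take_drop (wordThree_eq_wordTwo_append (a := t) (b := y - t) (by omega) x z)
      (by simp)]
  · have := Finset.mem_range.1 ht
    rw [pairInd_take_drop (wordThree_eq_append_replicate (a := t) (b := z - t) (by omega) x y)
      (by simp; omega), pairInd_replicate_right (true_mem_wordThree _ _ _)]

theorem splitCount_zero_two_pow {k n : ℕ} (hn : n ≤ 2 ^ k) : splitCount n 0 (2 ^ k) = n := by
  rw [splitCount, Finset.sum_congr rfl (g := fun _ => 1), Finset.sum_const, Finset.card_range,
    smul_eq_mul, mul_one]
  intro a ha
  have := Finset.mem_range.1 ha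
  rw [disjBits_zero_right, disjBits, Nat.and_two_pow, Nat.testBit_lt_two_pow (by omega)]
  simp

theorem disjBits_eq_one_of_add_eq {k i j : ℕ} (h : i + j + 1 = 2 ^ k) : disjBits i j = 1 := by
  induction k generalizing i j with
  | zero => simp [show i = 0 by simp at h; omega]
  | succ k ih =>
    rw [pow_succ] at h
    obtain ⟨i, rfl | rfl⟩ := Nat.even_or_odd' i <;>
    obtain ⟨j, rfl | rfl⟩ := Nat.even_or_odd' j
    · omega
    · rw [disjBits_even_odd, ih (by omega)]
    · rw [disjBits_odd_even, ih (by omega)]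
    · omega

/-- The indicator of `0^x 1 0^y 1 0^z` being Ulam. -/
noncomputable def ulamGrid (y x z : ℕ) : ℕ := ulamInd (wordThree x y z)

theorem ulamGrid_eq (y x z : ℕ) :
    ulamGrid y x z =
      if (if x = 0 then 0 else ulamGrid y (x - 1) z) + properSplitCount y x z +
        (if z = 0 then 0 else ulamGrid y x (z - 1)) = 1 then 1 else 0 := by
  classical
  rw [ulamGrid, ulamInd]
  exact if_congr (isUlam_wordThree_iff x y z) rfl rfl

theorem mem_ulamSet_iff (y x z : ℕ) : (x, z) ∈ UlamSet y ↔ ulamGrid y x z = 1 := by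
  simp [UlamSet, ulamGrid, ulamInd]

theorem properSplitCount_of_ne {y x z : ℕ} (h : x + z ≠ y) :
    properSplitCount y x z = splitCount (y + 1) x z := by
  simp [properSplitCount, h]

theorem properSplitCount_of_disjBits_eq_zero {y x z : ℕ} (h : disjBits x z = 0) :
    properSplitCount y x z = splitCount (y + 1) x z := by
  simp [properSplitCount, h]

theorem properSplitCount_le (y x z : ℕ) : properSplitCount y x z ≤ splitCount (y + 1) x z :=
  Nat.sub_le _ _

theorem ulamGrid_of_left_eq_zero {y x z : ℕ} (hl : x ≠ 0 → ulamGrid y (x - 1) z = 0) :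
    ulamGrid y x z =
      if properSplitCount y x z + (if z = 0 then 0 else ulamGrid y x (z - 1)) = 1
      then 1 else 0 := by
  rw [ulamGrid_eq]
  by_cases hx : x = 0
  · simp [hx]
  · simp [hx, hl hx]

theorem ulamGrid_of_right_eq_zero {y x z : ℕ} (hr : z ≠ 0 → ulamGrid y x (z - 1) = 0) :
    ulamGrid y x z =
      if (if x = 0 then 0 else ulamGrid y (x - 1) z) + properSplitCount y x z = 1
      then 1 else 0 := by
  rw [ulamGrid_eq]
  by_cases hz : z = 0
  · simp [hz]
  · simp [hz, hr hz]

theorem ulamGrid_of_neighbors_eq_zero {y x z : ℕ} (hl : x ≠ 0 → ulamGrid y (x - 1) z = 0)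
    (hr : z ≠ 0 → ulamGrid y x (z - 1) = 0) :
    ulamGrid y x z = if properSplitCount y x z = 1 then 1 else 0 := by
  rw [ulamGrid_of_left_eq_zero hl]
  by_cases hz : z = 0
  · simp [hz]
  · simp [hz, hr hz]

/-! ### Odd `y` -/

theorem ulamGrid_odd_odd_eq_zero {w y : ℕ} (hy : y + 1 = 2 * w) (i j : ℕ) :
    ulamGrid y (2 * i + 1) (2 * j + 1) = 0 := by
  induction hs : i + j using Nat.strong_induction_on generalizing i j with
  | _ s ih =>
    have h1 : ulamGrid y (2 * i) (2 * j + 1) =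
        if properSplitCount y (2 * i) (2 * j + 1) + ulamGrid y (2 * i) (2 * j) = 1
        then 1 else 0 := by
      rw [ulamGrid_of_left_eq_zero fun hi => ?_]
      · simp
      · rw [show 2 * i - 1 = 2 * (i - 1) + 1 by omega, ih _ (by omega) _ _ rfl]
    have h2 : ulamGrid y (2 * i + 1) (2 * j) =
        if ulamGrid y (2 * i) (2 * j) + properSplitCount y (2 * i + 1) (2 * j) = 1
        then 1 else 0 := by
      rw [ulamGrid_of_right_eq_zero fun hj => ?_]
      · simp
      · rw [show 2 * j - 1 = 2 * (j - 1) + 1 by omega, ih _ (by omega) _ _ rfl]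
    have hN : properSplitCount y (2 * i + 1) (2 * j) = properSplitCount y (2 * i) (2 * j + 1) := by
      simp only [properSplitCount, hy, splitCount_even_oe, splitCount_even_eo, disjBits_even_odd,
        disjBits_odd_even, show 2 * i + 1 + 2 * j = 2 * i + (2 * j + 1) by omega]
    have h0 : properSplitCount y (2 * i + 1) (2 * j + 1) = 0 := by
      have := properSplitCount_le y (2 * i + 1) (2 * j + 1)
      rwa [hy, splitCount_even_oo, Nat.le_zero] at this
    rw [ulamGrid_eq]
    simp only [Nat.add_sub_cancel, h0, h1, h2, hN, Nat.succ_ne_zero, if_false]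
    split_ifs <;> omega

/-- Two splittings off the square case prevent an even-even word from being Ulam. -/
theorem ulamGrid_even_even_eq_zero {k w y i j : ℕ} (hy : y + 1 = 2 * w) (hw : w ≤ 2 ^ k)
    (h : 2 * 2 ^ k = i % 2 ^ k + j % 2 ^ k + w + 1) : ulamGrid y (2 * i) (2 * j) = 0 := by
  rw [ulamGrid_eq, properSplitCount_of_ne (by omega), hy, splitCount_even_eq_two hw h,
    if_neg (by omega)]

theorem ulamGrid_eq_one_of_odd {k w y x z : ℕ} (hy : y + 1 = 2 * w) (hw : w ≤ 2 ^ k)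
    (h : 2 * 2 ^ (k + 1) = x % 2 ^ (k + 1) + z % 2 ^ (k + 1) + 2 * w + 1) (hne : x + z ≠ y) :
    ulamGrid y x z = 1 := by
  have hC : splitCount (y + 1) x z = 1 := by
    rw [hy]
    exact splitCount_eq_one (by rw [pow_succ]; omega) h
  have hp := pow_succ 2 k
  rw [ulamGrid_of_neighbors_eq_zero, properSplitCount_of_ne hne, hC, if_pos rfl] <;>
  · intro h0
    obtain ⟨i, rfl | rfl⟩ := Nat.even_or_odd' x <;>
    obtain ⟨j, rfl | rfl⟩ := Nat.even_or_odd' z <;>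
    simp only [two_mul_mod_two_pow_succ, two_mul_add_one_mod_two_pow_succ] at h <;>
    first
    | omega
    | exact ulamGrid_even_even_eq_zero hy hw (by omega)
    | rw [show 2 * i - 1 = 2 * (i - 1) + 1 by omega]; exact ulamGrid_odd_odd_eq_zero hy _ _
    | rw [show 2 * j - 1 = 2 * (j - 1) + 1 by omega]; exact ulamGrid_odd_odd_eq_zero hy _ _

/-! ### Even `y` -/

theorem disjBits_le_one (a x : ℕ) : disjBits a x ≤ 1 := by
  unfold disjBits
  split_ifs <;> simp

/-- On an even diagonal a word is not Ulam, provided its neighbors on the preceding diagonal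
are Ulam exactly when they have a unique splitting into words with one `1` each. -/
theorem ulamGrid_eq_zero_of_even {v x z : ℕ} (hv : 0 < v) (hs : (x + z) % 2 = 0)
    (hsq : x + z ≠ 2 * v ∨ disjBits x z = 0 ∨ 3 ≤ splitCount (2 * v + 1) x z)
    (hl : x ≠ 0 → ulamGrid (2 * v) (x - 1) z =
      if splitCount (2 * v + 1) (x - 1) z = 1 then 1 else 0)
    (hr : z ≠ 0 → ulamGrid (2 * v) x (z - 1) =
      if splitCount (2 * v + 1) x (z - 1) = 1 then 1 else 0) :
    ulamGrid (2 * v) x z = 0 := by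
  rw [ulamGrid_eq, if_neg]
  by_cases h3 : 3 ≤ splitCount (2 * v + 1) x z
  · have := disjBits_le_one x z
    unfold properSplitCount
    split_ifs <;> omega
  have hN : properSplitCount (2 * v) x z = splitCount (2 * v + 1) x z := by
    obtain h | h | h := hsq
    · exact properSplitCount_of_ne h
    · exact properSplitCount_of_disjBits_eq_zero h
    · exact absurd h h3
  rw [hN]
  obtain ⟨i, rfl | rfl⟩ := Nat.even_or_odd' x <;>
  obtain ⟨j, rfl | rfl⟩ := Nat.even_or_odd' z
  · have hL : (if 2 * i = 0 then 0 else ulamGrid (2 * v) (2 * i - 1) (2 * j)) =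
        if i ≠ 0 ∧ splitCount (v + 1) (i - 1) j = 1 then 1 else 0 := by
      by_cases hi : i = 0
      · simp [hi]
      · rw [if_neg (by omega), hl (by omega), show 2 * i - 1 = 2 * (i - 1) + 1 by omega,
          splitCount_odd_oe]
        simp [hi]
    have hR : (if 2 * j = 0 then 0 else ulamGrid (2 * v) (2 * i) (2 * j - 1)) =
        if j ≠ 0 ∧ splitCount (v + 1) i (j - 1) = 1 then 1 else 0 := by
      by_cases hj : j = 0
      · simp [hj]
      · rw [if_neg (by omega), hr (by omega), show 2 * j - 1 = 2 * (j - 1) + 1 by omega,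
          splitCount_odd_eo]
        simp [hj]
    have pl (hi : i ≠ 0) : (splitCount (v + 1) i j + splitCount v i j) % 2 =
        splitCount (v + 1) (i - 1) j % 2 := by
      simpa only [Nat.sub_add_cancel (Nat.pos_of_ne_zero hi)] using
        splitCount_add_succ_parity v (i - 1) j
    have pr (hj : j ≠ 0) : (splitCount (v + 1) i j + splitCount v i j) % 2 =
        splitCount (v + 1) i (j - 1) % 2 := by
      simpa only [Nat.sub_add_cancel (Nat.pos_of_ne_zero hj)] using
        splitCount_add_succ_parity' v i (j - 1)
    have he := exists_splitCount_pred_eq_one (i := i) (j := j) hv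
    rw [hL, hR, splitCount_odd_ee]
    clear hL hR hN hl hr hsq h3
    split_ifs <;> omega
  · omega
  · omega
  · have h1 := hl (by omega)
    have h2 := hr (by omega)
    rw [Nat.add_sub_cancel, splitCount_odd_eo] at h1
    rw [Nat.add_sub_cancel, splitCount_odd_oe] at h2
    rw [Nat.add_sub_cancel, Nat.add_sub_cancel, h1, h2, splitCount_odd_oo,
      if_neg (Nat.succ_ne_zero _), if_neg (Nat.succ_ne_zero _)]
    split_ifs <;> omega

theorem ulamGrid_of_odd {v x z : ℕ} (hs : (x + z) % 2 = 1)
    (hl : x ≠ 0 → ulamGrid (2 * v) (x - 1) z = 0) (hr : z ≠ 0 → ulamGrid (2 * v) x (z - 1) = 0) :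
    ulamGrid (2 * v) x z = if splitCount (2 * v + 1) x z = 1 then 1 else 0 := by
  rw [ulamGrid_of_neighbors_eq_zero hl hr, properSplitCount_of_ne (by omega)]

theorem ulamGrid_eq_zero_of_even_of_ne_two_pow {v : ℕ} (hv : 0 < v) (hq : ∀ q, v + 1 ≠ 2 ^ q)
    (x z : ℕ) (hs : (x + z) % 2 = 0) : ulamGrid (2 * v) x z = 0 := by
  induction hn : x + z using Nat.strong_induction_on generalizing x z with
  | _ n ih =>
    refine ulamGrid_eq_zero_of_even hv hs ?_
      (fun hx => ulamGrid_of_odd (by omega)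
        (fun _ => ih _ (by omega) _ _ (by omega) rfl) fun _ => ih _ (by omega) _ _ (by omega) rfl)
      (fun hz => ulamGrid_of_odd (by omega)
        (fun _ => ih _ (by omega) _ _ (by omega) rfl) fun _ => ih _ (by omega) _ _ (by omega) rfl)
    by_contra! h
    obtain ⟨i, rfl | rfl⟩ := Nat.even_or_odd' x <;>
    obtain ⟨j, rfl | rfl⟩ := Nat.even_or_odd' z
    · obtain rfl : v = i + j := by omega
      rw [disjBits_even_even, splitCount_odd_ee] at h
      have := three_le_splitCount_of_disjBits (i := i) (j := j)
        (by have := disjBits_le_one i j; omega) hq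
      omega
    · omega
    · omega
    · simp at h

theorem ulamGrid_eq_one_of_ne_two_pow {k v x z : ℕ} (hv : 0 < v) (hq : ∀ q, v + 1 ≠ 2 ^ q)
    (hk : 2 * v + 1 ≤ 2 ^ k) (h : 2 * 2 ^ k = x % 2 ^ k + z % 2 ^ k + (2 * v + 1) + 2)
    (hs : (x + z) % 2 = 1) : ulamGrid (2 * v) x z = 1 := by
  rw [ulamGrid_of_odd hs, splitCount_odd_eq_one hk h, if_pos rfl]
  · exact fun _ => ulamGrid_eq_zero_of_even_of_ne_two_pow hv hq _ _ (by omega)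
  · exact fun _ => ulamGrid_eq_zero_of_even_of_ne_two_pow hv hq _ _ (by omega)

theorem splitCount_eq_one_of_add_eq {k v i j : ℕ} (hk : v + 1 = 2 ^ k) (hv : 0 < v)
    (h : i + j = v) : splitCount (v + 1) i j = 1 ∧ splitCount v i j = 1 := by
  have hi : i % 2 ^ k = i := Nat.mod_eq_of_lt (by omega)
  have hj : j % 2 ^ k = j := Nat.mod_eq_of_lt (by omega)
  refine ⟨splitCount_eq_one (k := k) (by omega) (by omega), ?_⟩
  obtain _ | l := k
  · omega
  · have := pow_succ 2 l
    obtain ⟨w, rfl | rfl⟩ := Nat.even_or_odd' v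
    · omega
    · exact splitCount_odd_eq_one (k := l + 1) (by omega) (by omega)

theorem ulamGrid_even_even_of_add_eq {k v i j : ℕ} (hk : v + 1 = 2 ^ k) (hv : 0 < v)
    (h : i + j = v)
    (hl : i ≠ 0 → ulamGrid (2 * v) (2 * i - 1) (2 * j) =
      if splitCount (2 * v + 1) (2 * i - 1) (2 * j) = 1 then 1 else 0)
    (hr : j ≠ 0 → ulamGrid (2 * v) (2 * i) (2 * j - 1) =
      if splitCount (2 * v + 1) (2 * i) (2 * j - 1) = 1 then 1 else 0) :
    ulamGrid (2 * v) (2 * i) (2 * j) = 1 := by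
  obtain ⟨h1, h2⟩ := splitCount_eq_one_of_add_eq hk hv h
  rw [ulamGrid_of_neighbors_eq_zero]
  · have hd : disjBits i j = 1 := disjBits_eq_one_of_add_eq (k := k) (by omega)
    have hs : 2 * i + 2 * j = 2 * v := by omega
    simp [properSplitCount, hs, splitCount_odd_ee, h1, h2, hd]
  · intro hi
    have p := splitCount_add_succ_parity v (i - 1) j
    rw [Nat.sub_add_cancel (by omega), h1, h2] at p
    rw [hl (by omega), show 2 * i - 1 = 2 * (i - 1) + 1 by omega, splitCount_odd_oe,
      if_neg (by omega)]
  · intro hj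
    have p := splitCount_add_succ_parity' v i (j - 1)
    rw [Nat.sub_add_cancel (by omega), h1, h2] at p
    rw [hr (by omega), show 2 * j - 1 = 2 * (j - 1) + 1 by omega, splitCount_odd_eo,
      if_neg (by omega)]

theorem splitCount_of_add_eq_succ {k v x z : ℕ} (hk : v + 1 = 2 ^ k) (h : x + z = 2 * v + 1) :
    splitCount (2 * v + 1) x z = 1 := by
  have hp := pow_succ 2 k
  refine splitCount_odd_eq_one (k := k + 1) (by omega) ?_
  rw [Nat.mod_eq_of_lt (by omega), Nat.mod_eq_of_lt (by omega)]
  omega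

theorem splitCount_eq_one_iff_of_add_eq_add_two {k v x z : ℕ} (hk : v + 1 = 2 ^ k) (hv : 0 < v)
    (h : x + z = 2 * v + 2) : splitCount (2 * v + 1) x z = 1 ↔ x ≠ 0 ∧ z ≠ 0 := by
  have hp := pow_succ 2 k
  by_cases hx : x = 0
  · obtain rfl : z = 2 ^ (k + 1) := by omega
    rw [hx, splitCount_zero_two_pow (by omega)]
    omega
  by_cases hz : z = 0
  · obtain rfl : x = 2 ^ (k + 1) := by omega
    rw [hz, splitCount_comm, splitCount_zero_two_pow (by omega)]
    omega
  refine iff_of_true (splitCount_eq_one (k := k + 1) (by omega) ?_) ⟨hx, hz⟩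
  rw [Nat.mod_eq_of_lt (by omega), Nat.mod_eq_of_lt (by omega)]
  omega

theorem splitCount_of_add_eq_add_three {k v x z : ℕ} (hk : v + 1 = 2 ^ k) (hv : 0 < v)
    (h : x + z = 2 * v + 3) (hx : x ≠ 0) (hz : z ≠ 0) :
    2 ≤ splitCount (2 * v + 1) x z ∨ splitCount (2 * v + 1) x z = 0 ∧ x ≠ 1 ∧ z ≠ 1 := by
  have hp := pow_succ 2 k
  by_cases hx1 : x = 1
  · have h2 : splitCount (2 * v + 1) (2 * 0 + 1) (2 * (v + 1)) = v + 1 := by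
      rw [splitCount_odd_oe, hk, splitCount_zero_two_pow le_rfl]
    rw [show x = 2 * 0 + 1 by omega, show z = 2 * (v + 1) by omega, h2]
    omega
  by_cases hz1 : z = 1
  · have h2 : splitCount (2 * v + 1) (2 * (v + 1)) (2 * 0 + 1) = v + 1 := by
      rw [splitCount_odd_eo, hk, splitCount_comm, splitCount_zero_two_pow le_rfl]
    rw [show z = 2 * 0 + 1 by omega, show x = 2 * (v + 1) by omega, h2]
    omega
  refine Or.inr ⟨splitCount_eq_zero (k := k + 1) (by omega) ?_, hx1, hz1⟩
  rw [Nat.mod_eq_of_lt (by omega), Nat.mod_eq_of_lt (by omega)]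
  omega

/-- The full description of the grid when `y + 2` is a power of `2`. -/
theorem ulamGrid_two_pow_sub_two {k v : ℕ} (hk : v + 1 = 2 ^ k) (hv : 0 < v) (x z : ℕ) :
    ((x + z) % 2 = 0 → ulamGrid (2 * v) x z =
      if (x + z = 2 * v ∧ x % 2 = 0) ∨ (x + z = 2 * v + 2 ∧ x ≠ 0 ∧ z ≠ 0) then 1 else 0) ∧
    ((x + z) % 2 = 1 → ulamGrid (2 * v) x z =
      if x + z ≠ 2 * v + 1 ∧ splitCount (2 * v + 1) x z = 1 then 1 else 0) := by
  induction hn : x + z using Nat.strong_induction_on generalizing x z with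
  | _ n ih =>
  subst hn
  have hl (hx : x ≠ 0) := ih _ (by omega) (x - 1) z rfl
  have hr (hz : z ≠ 0) := ih _ (by omega) x (z - 1) rfl
  clear ih
  constructor <;> intro hs
  · replace hl (hx : x ≠ 0) := (hl hx).2 (by omega)
    replace hr (hz : z ≠ 0) := (hr hz).2 (by omega)
    by_cases h2 : x + z = 2 * v + 2
    · rw [ulamGrid_of_neighbors_eq_zero (fun hx => by rw [hl hx, if_neg (by omega)])
        (fun hz => by rw [hr hz, if_neg (by omega)]), properSplitCount_of_ne (by omega)]
      have := splitCount_eq_one_iff_of_add_eq_add_two hk hv h2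
      exact if_congr (this.trans (by omega)) rfl rfl
    have hl' (hx : x ≠ 0) : ulamGrid (2 * v) (x - 1) z =
        if splitCount (2 * v + 1) (x - 1) z = 1 then 1 else 0 := by
      rw [hl hx]
      exact if_congr (by omega) rfl rfl
    have hr' (hz : z ≠ 0) : ulamGrid (2 * v) x (z - 1) =
        if splitCount (2 * v + 1) x (z - 1) = 1 then 1 else 0 := by
      rw [hr hz]
      exact if_congr (by omega) rfl rfl
    by_cases h0 : x + z = 2 * v ∧ x % 2 = 0
    · rw [if_pos (Or.inl h0)]
      obtain ⟨i, rfl | rfl⟩ := Nat.even_or_odd' x <;>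
      obtain ⟨j, rfl | rfl⟩ := Nat.even_or_odd' z <;> try omega
      exact ulamGrid_even_even_of_add_eq hk hv (by omega) (fun h => hl' (by omega))
        (fun h => hr' (by omega))
    · rw [if_neg (by omega)]
      refine ulamGrid_eq_zero_of_even hv hs ?_ hl' hr'
      by_contra! h
      obtain ⟨i, rfl | rfl⟩ := Nat.even_or_odd' x <;>
      obtain ⟨j, rfl | rfl⟩ := Nat.even_or_odd' z <;> try omega
      simp at h
  · replace hl (hx : x ≠ 0) := (hl hx).1 (by omega)
    replace hr (hz : z ≠ 0) := (hr hz).1 (by omega)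
    by_cases h1 : x + z = 2 * v + 1
    · rw [ulamGrid_eq, properSplitCount_of_ne (by omega), splitCount_of_add_eq_succ hk h1,
        if_neg, if_neg (by omega)]
      by_cases hx : x % 2 = 0
      · have hz : z ≠ 0 := by omega
        have := (hr hz).trans (if_pos (by omega))
        rw [if_neg hz]
        omega
      · have hx : x ≠ 0 := by omega
        have := (hl hx).trans (if_pos (by omega))
        rw [if_neg hx]
        omega
    by_cases h3 : x + z = 2 * v + 3 ∧ x ≠ 0 ∧ z ≠ 0
    · obtain ⟨h3, hx, hz⟩ := h3
      have hC := splitCount_of_add_eq_add_three hk hv h3 hx hz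
      rw [ulamGrid_eq, properSplitCount_of_ne (by omega), if_neg hx, if_neg hz, hl hx, hr hz]
      split_ifs <;> omega
    · rw [ulamGrid_of_odd hs]
      · exact if_congr (by omega) rfl rfl
      · exact fun hx => by rw [hl hx, if_neg (by omega)]
      · exact fun hz => by rw [hr hz, if_neg (by omega)]

/-- the second full diagonal, at
`m = 2⌊(2^(k+2)-y-3)/2⌋ + 1` (the odd element of `{2^(k+2)-y-2, 2^(k+2)-y-3}`). -/
theorem ulamSet_second_full_diagonal (k y : ℕ) (h1 : 2 ^ k ≤ y)
    (h2 : y < 2 ^ (k + 1)) :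
    (y ≠ 2 ^ (k + 1) - 1 → y ≠ 2 ^ (k + 1) - 2 →
      ∀ x z : ℕ,
        x % 2 ^ (k + 1) + z % 2 ^ (k + 1) = 2 * ((2 ^ (k + 2) - y - 3) / 2) + 1 →
        (x, z) ∈ UlamSet y) ∧
    ((y = 2 ^ (k + 1) - 1 ∨ y = 2 ^ (k + 1) - 2) →
      ∀ x z : ℕ,
        x % 2 ^ (k + 1) + z % 2 ^ (k + 1) = 2 * ((2 ^ (k + 2) - y - 3) / 2) + 1 →
        x + z ≠ 2 ^ (k + 1) - 1 → (x, z) ∈ UlamSet y) := by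
  have hp : 2 ^ (k + 1) = 2 * 2 ^ k := pow_succ' 2 k
  have hp' : 2 ^ (k + 2) = 2 * 2 ^ (k + 1) := pow_succ' 2 (k + 1)
  have hpos : 0 < 2 ^ k := by positivity
  have key (x z : ℕ)
      (h : x % 2 ^ (k + 1) + z % 2 ^ (k + 1) = 2 * ((2 ^ (k + 2) - y - 3) / 2) + 1)
      (h0 : (y = 2 ^ (k + 1) - 1 ∨ y = 2 ^ (k + 1) - 2) → x + z ≠ 2 ^ (k + 1) - 1) :
      (x, z) ∈ UlamSet y := by
    rw [mem_ulamSet_iff]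
    have hx := Nat.mod_le x (2 ^ (k + 1))
    have hz := Nat.mod_le z (2 ^ (k + 1))
    have hs : (x + z) % 2 = 1 := by
      have hx2 := Nat.mod_mod_of_dvd x (Dvd.intro _ hp.symm)
      have hz2 := Nat.mod_mod_of_dvd z (Dvd.intro _ hp.symm)
      omega
    obtain ⟨v, rfl | rfl⟩ := Nat.even_or_odd' y
    · have hv : 0 < v := by omega
      by_cases hq : ∀ q, v + 1 ≠ 2 ^ q
      · exact ulamGrid_eq_one_of_ne_two_pow (k := k + 1) hv hq (by omega) (by omega) hs
      · push Not at hq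
        obtain ⟨q, hq⟩ := hq
        obtain rfl : q = k := by
          refine le_antisymm (Nat.lt_succ_iff.1 ?_) (Nat.lt_succ_iff.1 ?_) <;>
          · rw [← Nat.pow_lt_pow_iff_right (a := 2) (by norm_num), pow_succ]
            omega
        rw [(ulamGrid_two_pow_sub_two hq hv x z).2 hs, if_pos]
        refine ⟨by omega, splitCount_odd_eq_one (k := q + 1) (by omega) (by omega)⟩
    · exact ulamGrid_eq_one_of_odd (k := k) (w := v + 1) (by omega) (by omega) (by omega)
        (by omega)
  exact ⟨fun hy hy' x z h => key x z h (by omega), fun hy x z h h0 => key x z h fun _ => h0⟩
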